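/- Let α ∈ (0,2) and γ > 1, and let μ be the pushforward of ν_α under the map z ↦ (z, |z|^γ sgn z) from ℝ to ℝ². Then there exist constants 0 < c ≤ C such that for all ε ∈ (0,1]: c ε^{2−α} ≤ ∫_{|u| ≤ ε} (u·e₁)² μ(du) ≤ C ε^{2−α} and c ε^{2γ−α} ≤ ∫_{|u| ≤ ε} (u·e₂)² μ(du) ≤ C ε^{2γ−α}, where e₁ = (1,0) and e₂ = (0,1). In particular, since γ > 1, there is no single exponent α' ∈ (0,2) for which ∫_{|u|≤ε}(u·ℓ)² μ(du) ≍ ε^{2−α'} holds as ε → 0 for all unit vectors ℓ, i.e. the scaling condition (1.1) of Simon fails for μ. -/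

import Mathlib

open MeasureTheory
open scoped RealInnerProductSpace

noncomputable section

/-- The symmetric α-stable Lévy measure on ℝ: density `|z|^(-1-α)` w.r.t. Lebesgue
measure (the density vanishes at `z = 0` by the convention `0 ^ (-1-α) = 0`). -/
def stableMeasure (α : ℝ) : Measure ℝ :=
  volume.withDensity fun z => ENNReal.ofReal (|z| ^ (-(1 + α)))

/-- The pushforward of the α-stable Lévy measure under `z ↦ (z, |z|^γ sgn z) ∈ ℝ²`. -/
def curveMeasure (α γ : ℝ) : Measure (EuclideanSpace ℝ (Fin 2)) :=
  Measure.map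
    (fun z : ℝ =>
      EuclideanSpace.single (0 : Fin 2) z +
        EuclideanSpace.single (1 : Fin 2) (|z| ^ γ * Real.sign z))
    (stableMeasure α)

/-- The map `z ↦ (z, |z|^γ sgn z)` is measurable. -/
theorem measurable_curve (γ : ℝ) : Measurable (fun z : ℝ =>
    EuclideanSpace.single (0 : Fin 2) z +
      EuclideanSpace.single (1 : Fin 2) (|z| ^ γ * Real.sign z)) := by
  have hsign : Measurable Real.sign :=
    Measurable.ite measurableSet_Iio measurable_const
      (Measurable.ite measurableSet_Ioi measurable_const measurable_const)
  have habs : Measurable fun z : ℝ => |z| ^ γ := by fun_prop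
  have hsingle (i : Fin 2) : Measurable fun z : ℝ => EuclideanSpace.single i z :=
    (Isometry.of_dist_eq (PiLp.dist_single_same 2 (fun _ : Fin 2 => ℝ) i)).continuous.measurable
  exact (hsingle 0).add ((hsingle 1).comp (habs.mul hsign))

theorem intervalIntegrable_abs_rpow_zero_right {s r : ℝ} (hs : -1 < s) (hr : 0 ≤ r) :
    IntervalIntegrable (fun z : ℝ => |z| ^ s) volume 0 r := by
  refine (intervalIntegral.intervalIntegrable_rpow' hs).congr fun z hz => ?_
  rw [Set.uIoc_of_le hr] at hz
  simp only [abs_of_pos hz.1]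

theorem intervalIntegrable_abs_rpow_neg_zero {s r : ℝ} (hs : -1 < s) (hr : 0 ≤ r) :
    IntervalIntegrable (fun z : ℝ => |z| ^ s) volume (-r) 0 := by
  rw [IntervalIntegrable.iff_comp_neg]
  simpa using (intervalIntegrable_abs_rpow_zero_right hs hr).symm

theorem integrableOn_Icc_abs_rpow {s r : ℝ} (hs : -1 < s) (hr : 0 ≤ r) :
    IntegrableOn (fun z : ℝ => |z| ^ s) (Set.Icc (-r) r) := by
  rw [integrableOn_Icc_iff_integrableOn_Ioc,
    ← intervalIntegrable_iff_integrableOn_Ioc_of_le (by linarith)]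
  exact (intervalIntegrable_abs_rpow_neg_zero hs hr).trans
    (intervalIntegrable_abs_rpow_zero_right hs hr)

theorem integral_Icc_abs_rpow {s r : ℝ} (hs : -1 < s) (hr : 0 ≤ r) :
    ∫ z in Set.Icc (-r) r, |z| ^ s = 2 / (s + 1) * r ^ (s + 1) := by
  have h : ∫ z in (0 : ℝ)..r, |z| ^ s = r ^ (s + 1) / (s + 1) := by
    have hcongr : ∫ z in (0 : ℝ)..r, |z| ^ s = ∫ z in (0 : ℝ)..r, z ^ s := by
      refine intervalIntegral.integral_congr fun z hz => ?_
      rw [Set.uIcc_of_le hr] at hz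
      simp only [abs_of_nonneg hz.1]
    rw [hcongr, integral_rpow (Or.inl hs), Real.zero_rpow (by linarith), sub_zero]
  have h' : ∫ z in (-r)..0, |z| ^ s = r ^ (s + 1) / (s + 1) := by
    rw [← h]
    simpa using (intervalIntegral.integral_comp_neg (a := 0) (b := r) fun z : ℝ => |z| ^ s).symm
  rw [integral_Icc_eq_integral_Ioc, ← intervalIntegral.integral_of_le (by linarith),
    ← intervalIntegral.integral_add_adjacent_intervals
      (intervalIntegrable_abs_rpow_neg_zero hs hr)
      (intervalIntegrable_abs_rpow_zero_right hs hr), h, h']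
  ring

theorem sq_norm_curve (γ z : ℝ) :
    ‖EuclideanSpace.single (0 : Fin 2) z +
      EuclideanSpace.single (1 : Fin 2) (|z| ^ γ * Real.sign z)‖ ^ 2 =
      z ^ 2 + (|z| ^ γ * Real.sign z) ^ 2 := by
  rw [EuclideanSpace.norm_sq_eq]
  simp

theorem abs_sign_le_one (z : ℝ) : |Real.sign z| ≤ 1 := by
  rcases Real.sign_apply_eq z with h | h | h <;> simp [h]

theorem abs_le_norm_curve (γ z : ℝ) :
    |z| ≤ ‖EuclideanSpace.single (0 : Fin 2) z +
      EuclideanSpace.single (1 : Fin 2) (|z| ^ γ * Real.sign z)‖ := by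
  refine abs_le_of_sq_le_sq ?_ (norm_nonneg _)
  rw [sq_norm_curve]
  nlinarith [sq_nonneg (|z| ^ γ * Real.sign z)]

theorem norm_curve_le {γ z : ℝ} (hγ : 1 ≤ γ) (hz : |z| ≤ 1) :
    ‖EuclideanSpace.single (0 : Fin 2) z +
      EuclideanSpace.single (1 : Fin 2) (|z| ^ γ * Real.sign z)‖ ≤ 2 * |z| := by
  have hpow : |z| ^ γ ≤ |z| := by
    simpa using Real.rpow_le_rpow_of_exponent_ge' (abs_nonneg z) hz zero_le_one hγ
  refine (norm_add_le _ _).trans ?_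
  simp only [PiLp.norm_single, Real.norm_eq_abs, abs_mul,
    abs_of_nonneg (Real.rpow_nonneg (abs_nonneg z) γ)]
  nlinarith [mul_le_of_le_one_right (Real.rpow_nonneg (abs_nonneg z) γ) (abs_sign_le_one z)]

/-- Integrals over a ball against the curve measure, written as integrals on the line. -/
theorem setIntegral_curveMeasure {α γ p ε : ℝ} {f : EuclideanSpace ℝ (Fin 2) → ℝ}
    (hf : Measurable f)
    (hfp : ∀ z : ℝ, f (EuclideanSpace.single (0 : Fin 2) z +
      EuclideanSpace.single (1 : Fin 2) (|z| ^ γ * Real.sign z)) = |z| ^ p) :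
    ∫ u in {u | ‖u‖ ≤ ε}, f u ∂(curveMeasure α γ) =
      ∫ z in {z : ℝ | ‖EuclideanSpace.single (0 : Fin 2) z +
        EuclideanSpace.single (1 : Fin 2) (|z| ^ γ * Real.sign z)‖ ≤ ε},
        |z| ^ (p - α - 1) := by
  have hball : MeasurableSet {u : EuclideanSpace ℝ (Fin 2) | ‖u‖ ≤ ε} :=
    measurableSet_le measurable_norm measurable_const
  rw [curveMeasure, setIntegral_map hball hf.aestronglyMeasurable
    (measurable_curve γ).aemeasurable, stableMeasure,
    setIntegral_withDensity_eq_setIntegral_toReal_smul (by fun_prop) (by simp) _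
      (measurable_curve γ hball)]
  refine setIntegral_congr_ae (measurable_curve γ hball) ?_
  filter_upwards [compl_mem_ae_iff.2 (measure_singleton (μ := volume) (0 : ℝ))] with z hz _
  have hz : 0 < |z| := abs_pos.2 hz
  rw [ENNReal.toReal_ofReal (by positivity), hfp, smul_eq_mul, ← Real.rpow_add hz]
  congr 1
  ring

/-- Truncated moments of the curve measure are comparable to a power of the radius. -/
theorem setIntegral_curveMeasure_bounds {α γ p ε : ℝ} {f : EuclideanSpace ℝ (Fin 2) → ℝ}
    (hf : Measurable f) (hγ : 1 ≤ γ) (hp : α < p) (hε : ε ∈ Set.Ioc (0 : ℝ) 1)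
    (hfp : ∀ z : ℝ, f (EuclideanSpace.single (0 : Fin 2) z +
      EuclideanSpace.single (1 : Fin 2) (|z| ^ γ * Real.sign z)) = |z| ^ p) :
    2 / (p - α) * (1 / 2) ^ (p - α) * ε ^ (p - α) ≤
        ∫ u in {u | ‖u‖ ≤ ε}, f u ∂(curveMeasure α γ) ∧
      ∫ u in {u | ‖u‖ ≤ ε}, f u ∂(curveMeasure α γ) ≤ 2 / (p - α) * ε ^ (p - α) := by
  obtain ⟨hε0, hε1⟩ := hε
  rw [setIntegral_curveMeasure hf hfp]
  set S := {z : ℝ | ‖EuclideanSpace.single (0 : Fin 2) z +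
        EuclideanSpace.single (1 : Fin 2) (|z| ^ γ * Real.sign z)‖ ≤ ε}
  have hsub : S ⊆ Set.Icc (-ε) ε := fun z hz =>
    abs_le.1 ((abs_le_norm_curve γ z).trans hz)
  have hsup : Set.Icc (-(1 / 2 * ε)) (1 / 2 * ε) ⊆ S := fun z hz => by
    have hz : |z| ≤ 1 / 2 * ε := abs_le.2 hz
    exact (norm_curve_le hγ (by linarith)).trans (by linarith)
  have hs : -1 < p - α - 1 := by linarith
  have hint := integrableOn_Icc_abs_rpow hs hε0.le
  have hnonneg (μ : Measure ℝ) : 0 ≤ᵐ[μ] fun z : ℝ => |z| ^ (p - α - 1) :=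
    Filter.Eventually.of_forall fun z => by positivity
  have hlow := setIntegral_mono_set (hint.mono_set hsub) (hnonneg _) hsup.eventuallyLE
  have hupp := setIntegral_mono_set hint (hnonneg _) hsub.eventuallyLE
  rw [integral_Icc_abs_rpow hs (by positivity), sub_add_cancel,
    Real.mul_rpow (by norm_num) hε0.le, ← mul_assoc] at hlow
  rw [integral_Icc_abs_rpow hs hε0.le, sub_add_cancel] at hupp
  exact ⟨hlow, hupp⟩

/-- If `c ε^a ≤ C ε^b` for small `ε`, with `c > 0`, then `b ≤ a`. -/
theorem le_of_mul_rpow_le_mul_rpow {a b c C : ℝ} (hc : 0 < c)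
    (h : ∀ ε ∈ Set.Ioc (0 : ℝ) 1, c * ε ^ a ≤ C * ε ^ b) : b ≤ a := by
  by_contra! hab
  have hlim : Filter.Tendsto (fun ε : ℝ => C * ε ^ (b - a))
      (nhdsWithin 0 (Set.Ioi 0)) (nhds (C * 0)) := by
    have := (Real.continuousAt_rpow_const 0 (b - a) (Or.inr (by linarith))).tendsto
    rw [Real.zero_rpow (by linarith)] at this
    exact (this.mono_left nhdsWithin_le_nhds).const_mul C
  have hle : c ≤ C * 0 := by
    refine ge_of_tendsto hlim ?_
    filter_upwards [Ioc_mem_nhdsGT (zero_lt_one' ℝ)] with ε hε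
    have hpos : 0 < ε ^ a := Real.rpow_pos_of_pos hε.1 a
    rw [Real.rpow_sub hε.1, ← mul_div_assoc, le_div_iff₀ hpos]
    exact h ε hε
  linarith

theorem sq_inner_curve_zero (γ z : ℝ) :
    ⟪EuclideanSpace.single (0 : Fin 2) z +
      EuclideanSpace.single (1 : Fin 2) (|z| ^ γ * Real.sign z),
      EuclideanSpace.single (0 : Fin 2) (1 : ℝ)⟫ ^ 2 = |z| ^ (2 : ℝ) := by
  simp [EuclideanSpace.inner_single_right]

theorem sq_inner_curve_one {γ : ℝ} (hγ : γ ≠ 0) (z : ℝ) :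
    ⟪EuclideanSpace.single (0 : Fin 2) z +
      EuclideanSpace.single (1 : Fin 2) (|z| ^ γ * Real.sign z),
      EuclideanSpace.single (1 : Fin 2) (1 : ℝ)⟫ ^ 2 = |z| ^ (2 * γ) := by
  have hpow : |z| ^ (2 * γ) = (|z| ^ γ) ^ 2 := by
    rw [mul_comm, Real.rpow_mul (abs_nonneg z), Real.rpow_two]
  rcases eq_or_ne z 0 with rfl | hz
  · simp [EuclideanSpace.inner_single_right, hγ]
  · rcases Real.sign_apply_eq_of_ne_zero z hz with h | h <;>
      simp [EuclideanSpace.inner_single_right, h, hpow]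

theorem statement_16 (α γ : ℝ) (hα : α ∈ Set.Ioo (0 : ℝ) 2) (hγ : 1 < γ) :
    (∃ c C : ℝ, 0 < c ∧ c ≤ C ∧
      ∀ ε ∈ Set.Ioc (0 : ℝ) 1,
        (c * ε ^ (2 - α) ≤
            ∫ u in {u | ‖u‖ ≤ ε},
              ⟪u, EuclideanSpace.single (0 : Fin 2) (1 : ℝ)⟫ ^ 2 ∂(curveMeasure α γ) ∧
          ∫ u in {u | ‖u‖ ≤ ε},
              ⟪u, EuclideanSpace.single (0 : Fin 2) (1 : ℝ)⟫ ^ 2 ∂(curveMeasure α γ) ≤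
            C * ε ^ (2 - α)) ∧
        (c * ε ^ (2 * γ - α) ≤
            ∫ u in {u | ‖u‖ ≤ ε},
              ⟪u, EuclideanSpace.single (1 : Fin 2) (1 : ℝ)⟫ ^ 2 ∂(curveMeasure α γ) ∧
          ∫ u in {u | ‖u‖ ≤ ε},
              ⟪u, EuclideanSpace.single (1 : Fin 2) (1 : ℝ)⟫ ^ 2 ∂(curveMeasure α γ) ≤
            C * ε ^ (2 * γ - α))) ∧
    -- in particular, the scaling condition (1.1) of Simon fails for μ:
    ¬ ∃ α' ∈ Set.Ioo (0 : ℝ) 2, ∃ c' C' : ℝ, 0 < c' ∧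
        ∀ ℓ : EuclideanSpace ℝ (Fin 2), ‖ℓ‖ = 1 →
          ∀ ε ∈ Set.Ioc (0 : ℝ) 1,
            c' * ε ^ (2 - α') ≤
                (∫ u in {u | ‖u‖ ≤ ε}, ⟪u, ℓ⟫ ^ 2 ∂(curveMeasure α γ)) ∧
              (∫ u in {u | ‖u‖ ≤ ε}, ⟪u, ℓ⟫ ^ 2 ∂(curveMeasure α γ)) ≤
                C' * ε ^ (2 - α') := by
  obtain ⟨-, hα2⟩ := hα
  have h0 (ε : ℝ) (hε : ε ∈ Set.Ioc (0 : ℝ) 1) :=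
    setIntegral_curveMeasure_bounds (f := fun u : EuclideanSpace ℝ (Fin 2) =>
      ⟪u, EuclideanSpace.single (0 : Fin 2) (1 : ℝ)⟫ ^ 2) (by fun_prop) hγ.le hα2 hε
      (sq_inner_curve_zero γ)
  have h1 (ε : ℝ) (hε : ε ∈ Set.Ioc (0 : ℝ) 1) :=
    setIntegral_curveMeasure_bounds (f := fun u : EuclideanSpace ℝ (Fin 2) =>
      ⟪u, EuclideanSpace.single (1 : Fin 2) (1 : ℝ)⟫ ^ 2) (by fun_prop) hγ.le
      (show α < 2 * γ by linarith) hε (sq_inner_curve_one (by linarith))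
  have hp0 : 0 < 2 - α := by linarith
  have hp1 : 0 < 2 * γ - α := by linarith
  have hc0 : 0 < 2 / (2 - α) * (1 / 2 : ℝ) ^ (2 - α) := by positivity
  have hc1 : 0 < 2 / (2 * γ - α) * (1 / 2 : ℝ) ^ (2 * γ - α) := by positivity
  refine ⟨⟨min (2 / (2 - α) * (1 / 2) ^ (2 - α)) (2 / (2 * γ - α) * (1 / 2) ^ (2 * γ - α)),
    max (2 / (2 - α)) (2 / (2 * γ - α)), lt_min hc0 hc1, ?_, fun ε hε => ?_⟩, ?_⟩
  · refine (min_le_left _ _).trans (le_trans ?_ (le_max_left _ _))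
    exact mul_le_of_le_one_right (by positivity)
      (Real.rpow_le_one (by norm_num) (by norm_num) hp0.le)
  · have hpos (s : ℝ) : 0 ≤ ε ^ s := Real.rpow_nonneg hε.1.le s
    exact ⟨⟨(mul_le_mul_of_nonneg_right (min_le_left _ _) (hpos _)).trans (h0 ε hε).1,
        (h0 ε hε).2.trans (mul_le_mul_of_nonneg_right (le_max_left _ _) (hpos _))⟩,
      (mul_le_mul_of_nonneg_right (min_le_right _ _) (hpos _)).trans (h1 ε hε).1,
      (h1 ε hε).2.trans (mul_le_mul_of_nonneg_right (le_max_right _ _) (hpos _))⟩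
  · rintro ⟨α', -, c', C', hc', h⟩
    have hle := le_of_mul_rpow_le_mul_rpow hc0 fun ε hε =>
      (h0 ε hε).1.trans (h (EuclideanSpace.single 0 1) (by simp) ε hε).2
    have hle' := le_of_mul_rpow_le_mul_rpow hc' fun ε hε =>
      (h (EuclideanSpace.single 1 1) (by simp) ε hε).1.trans (h1 ε hε).2
    linarith
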